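/- Let d ≥ 1 and s ≥ 1 be integers and let B ≥ 0. There exists a constant C = C(d, s, B) > 0 with the following property. Let E and Y be Banach spaces, let f : E → Y be s-times continuously differentiable with ‖(iterated Fréchet derivative of order i of f)(e)‖ ≤ B for all e ∈ E and all 0 ≤ i ≤ s, and let u : ℝ^d → E be s-times continuously differentiable with all derivatives of order ≤ s bounded and with sup_{x} ‖u(x)‖ ≤ B. Then ‖f ∘ u‖_{C^s} ≤ C (1 + ‖u‖_{C^s}), where ‖v‖_{C^j} := ∑_{i=0}^{j} sup_{x ∈ ℝ^d} ‖(iterated Fréchet derivative of order i of v)(x)‖. -/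

import Mathlib

universe u v

/-- The `C^j` norm `∑_{i=0}^{j} sup_x ‖D^i v(x)‖` of a map `v : ℝ^d → X`. -/
noncomputable def cNorm (d : ℕ) {X : Type u} [NormedAddCommGroup X] [NormedSpace ℝ X]
    (j : ℕ) (v : EuclideanSpace ℝ (Fin d) → X) : ℝ :=
  ∑ i ∈ Finset.range (j + 1), ⨆ x, ‖iteratedFDeriv ℝ i v x‖

/-- A map bounded by `A` whose derivative is Lipschitz with constant `L` has derivative bounded
by `2 A / h + h L`, for every `h > 0`. -/
theorem norm_fderiv_le_of_norm_le_of_lipschitz {V X : Type*} [NormedAddCommGroup V]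
    [NormedSpace ℝ V] [NormedAddCommGroup X] [NormedSpace ℝ X] {g : V → X} {A L h : ℝ}
    (hg : Differentiable ℝ g) (hA : ∀ x, ‖g x‖ ≤ A) (hL : 0 ≤ L)
    (hlip : ∀ x y, ‖fderiv ℝ g x - fderiv ℝ g y‖ ≤ L * ‖x - y‖) (hh : 0 < h) (x : V) :
    ‖fderiv ℝ g x‖ ≤ 2 * A / h + h * L := by
  have hA0 : 0 ≤ A := (norm_nonneg _).trans (hA x)
  refine ContinuousLinearMap.opNorm_le_of_unit_norm (by positivity) fun v hv => ?_
  have hnorm : ‖h • v‖ = h := by rw [norm_smul, hv, Real.norm_of_nonneg hh.le, mul_one]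
  have hball : ∀ z ∈ Metric.closedBall x h, ‖fderiv ℝ g z - fderiv ℝ g x‖ ≤ L * h := by
    intro z hz
    exact (hlip z x).trans (mul_le_mul_of_nonneg_left (mem_closedBall_iff_norm.1 hz) hL)
  have hrem := (convex_closedBall x h).norm_image_sub_le_of_norm_fderiv_le'
    (fun z _ => hg z) hball (Metric.mem_closedBall_self hh.le)
    (show x + h • v ∈ Metric.closedBall x h by simp [hnorm])
  rw [add_sub_cancel_left, hnorm] at hrem
  have hkey : ‖fderiv ℝ g x (h • v)‖ ≤ 2 * A + L * h * h := by
    have hsplit : fderiv ℝ g x (h • v) =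
        g (x + h • v) - g x - (g (x + h • v) - g x - fderiv ℝ g x (h • v)) := by abel
    rw [hsplit]
    have h1 := norm_sub_le (g (x + h • v) - g x) (g (x + h • v) - g x - fderiv ℝ g x (h • v))
    have h2 := norm_sub_le (g (x + h • v)) (g x)
    linarith [hA x, hA (x + h • v)]
  rw [map_smul, norm_smul, Real.norm_of_nonneg hh.le] at hkey
  rw [show 2 * A / h + h * L = (2 * A + L * h * h) / h by field_simp, le_div_iff₀ hh]
  linarith

/-- Interpolation between consecutive orders of differentiation. -/
theorem norm_iteratedFDeriv_succ_le_interpolation {V X : Type*} [NormedAddCommGroup V]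
    [NormedSpace ℝ V] [NormedAddCommGroup X] [NormedSpace ℝ X] {u : V → X} {k : ℕ} {A L h : ℝ}
    (hu : ContDiff ℝ (k + 2 : ℕ) u) (hA : ∀ x, ‖iteratedFDeriv ℝ k u x‖ ≤ A)
    (hL : ∀ x, ‖iteratedFDeriv ℝ (k + 2) u x‖ ≤ L) (hh : 0 < h) (x : V) :
    ‖iteratedFDeriv ℝ (k + 1) u x‖ ≤ 2 * A / h + h * L := by
  rw [← norm_fderiv_iteratedFDeriv]
  have hdiff : ∀ m < k + 2, Differentiable ℝ (iteratedFDeriv ℝ m u) := fun m hm =>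
    hu.differentiable_iteratedFDeriv (by exact_mod_cast hm)
  refine norm_fderiv_le_of_norm_le_of_lipschitz (hdiff k (by omega)) hA
    ((norm_nonneg _).trans (hL x)) (fun y z => ?_) hh x
  rw [fderiv_iteratedFDeriv]
  simp only [Function.comp_apply]
  rw [← dist_eq_norm, LinearIsometryEquiv.dist_map, dist_eq_norm]
  refine convex_univ.norm_image_sub_le_of_norm_fderiv_le
    (fun w _ => hdiff (k + 1) (by omega) w) (fun w _ => ?_) (Set.mem_univ z) (Set.mem_univ y)
  rw [norm_fderiv_iteratedFDeriv]
  exact hL w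

/-- Interpolation inequalities between neighbouring terms let each term of a sequence be absorbed
into the next one, up to a multiple of the initial term. -/
theorem exists_le_mul_succ_add_of_interpolation (k : ℕ) :
    ∀ ε : ℝ, 0 < ε → ∃ C : ℝ, 0 ≤ C ∧ ∀ (s : ℕ) (a : ℕ → ℝ), (∀ j, 0 ≤ a j) →
      (∀ j, j + 2 ≤ s → ∀ h : ℝ, 0 < h → a (j + 1) ≤ 2 * a j / h + h * a (j + 2)) →
      k + 1 ≤ s → a k ≤ ε * a (k + 1) + C * a 0 := by
  induction k with
  | zero =>
    intro ε hε
    refine ⟨1, zero_le_one, fun s a ha _ _ => ?_⟩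
    have := mul_nonneg hε.le (ha 1)
    simpa using this
  | succ k ih =>
    intro ε hε
    obtain ⟨C, hC, hCa⟩ := ih (ε / 8) (by positivity)
    refine ⟨8 * C / ε, by positivity, fun s a ha hint hk => ?_⟩
    have h1 := hCa s a ha hint (by omega)
    have h2 := hint k hk (ε / 2) (by positivity)
    have h3 : 2 * a k / (ε / 2) ≤ a (k + 1) / 2 + 4 * C / ε * a 0 := by
      calc 2 * a k / (ε / 2) ≤ 2 * (ε / 8 * a (k + 1) + C * a 0) / (ε / 2) := by gcongr
        _ = a (k + 1) / 2 + 4 * C / ε * a 0 := by field_simp; ring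
    have h4 : 8 * C / ε * a 0 = 2 * (4 * C / ε * a 0) := by ring
    rw [show k + 1 + 1 = k + 2 from rfl]
    linarith

/-- A sequence satisfying interpolation inequalities is controlled by its end terms. -/
theorem exists_le_of_interpolation (s : ℕ) (B : ℝ) (hB : 0 ≤ B) :
    ∃ K : ℝ, 1 ≤ K ∧ ∀ a : ℕ → ℝ, (∀ j, 0 ≤ a j) →
      (∀ j, j + 2 ≤ s → ∀ h : ℝ, 0 < h → a (j + 1) ≤ 2 * a j / h + h * a (j + 2)) →
      a 0 ≤ B → a s ≤ 1 → ∀ k ≤ s, a k ≤ K := by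
  choose C hC hCa using fun k => exists_le_mul_succ_add_of_interpolation k 1 one_pos
  have hsum : ∀ m, 0 ≤ ∑ j ∈ Finset.range m, C j * B := fun m =>
    Finset.sum_nonneg fun j _ => mul_nonneg (hC j) hB
  refine ⟨1 + ∑ j ∈ Finset.range s, C j * B, by linarith [hsum s], ?_⟩
  intro a ha hint h0 hs k hk
  have hdown : a k + ∑ j ∈ Finset.range k, C j * B ≤ 1 + ∑ j ∈ Finset.range s, C j * B := by
    induction hk using Nat.decreasingInduction with
    | self => linarith
    | of_succ k hk ih =>
      rw [Finset.sum_range_succ] at ih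
      have := hCa k s a ha hint hk
      have := mul_le_mul_of_nonneg_left h0 (hC k)
      linarith
  linarith [hsum k]

/-- tame (Moser-type) estimate for the composition in `C^s` spaces:
if all derivatives of `f` of order `≤ s` are bounded by `B` and `u` is `C^s` with
bounded derivatives and `sup_x ‖u(x)‖ ≤ B`, then
`‖f ∘ u‖_{C^s} ≤ C (1 + ‖u‖_{C^s})` with `C = C(d, s, B)`. -/
theorem stmt10 (d s : ℕ) (hd : 1 ≤ d) (hs : 1 ≤ s) (B : ℝ) (hB : 0 ≤ B) :
    ∃ C : ℝ, 0 < C ∧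
      ∀ (E : Type u) (Y : Type v)
        [NormedAddCommGroup E] [NormedSpace ℝ E] [CompleteSpace E]
        [NormedAddCommGroup Y] [NormedSpace ℝ Y] [CompleteSpace Y]
        (f : E → Y) (u : EuclideanSpace ℝ (Fin d) → E),
        ContDiff ℝ s f →
        (∀ i : ℕ, i ≤ s → ∀ e : E, ‖iteratedFDeriv ℝ i f e‖ ≤ B) →
        ContDiff ℝ s u →
        (∀ i : ℕ, i ≤ s → BddAbove (Set.range fun x => ‖iteratedFDeriv ℝ i u x‖)) →
        (∀ x, ‖u x‖ ≤ B) →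
        cNorm d s (f ∘ u) ≤ C * (1 + cNorm d s u) := by
  obtain ⟨K, hK, hKa⟩ := exists_le_of_interpolation s B hB
  have hK0 : 0 ≤ K := zero_le_one.trans hK
  have hsum : 0 ≤ ∑ i ∈ Finset.range (s + 1), (i.factorial : ℝ) * B * K ^ i :=
    Finset.sum_nonneg fun i _ => by positivity
  refine ⟨1 + ∑ i ∈ Finset.range (s + 1), (i.factorial : ℝ) * B * K ^ i, by linarith, ?_⟩
  intro E Y _ _ _ _ _ _ f u hf hfB hu hbdd huB
  set A : ℕ → ℝ := fun i => ⨆ x, ‖iteratedFDeriv ℝ i u x‖ with hA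
  have hA0 : ∀ i, 0 ≤ A i := fun i => Real.iSup_nonneg fun x => norm_nonneg _
  have hleA : ∀ i ≤ s, ∀ x, ‖iteratedFDeriv ℝ i u x‖ ≤ A i := fun i hi x =>
    le_ciSup (hbdd i hi) x
  have hAs : A s ≤ cNorm d s u :=
    Finset.single_le_sum (f := A) (fun i _ => hA0 i) (Finset.self_mem_range_succ s)
  have hM : 0 ≤ cNorm d s u := (hA0 s).trans hAs
  set T : ℝ := (1 + cNorm d s u) ^ (s : ℝ)⁻¹ with hT
  have hTs : T ^ s = 1 + cNorm d s u :=
    Real.rpow_inv_natCast_pow (by linarith) (by omega)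
  have hT1 : 1 ≤ T := Real.one_le_rpow (by linarith) (by positivity)
  have hT0 : 0 < T := zero_lt_one.trans_le hT1
  have hAK : ∀ k ≤ s, A k / T ^ k ≤ K := by
    refine hKa (fun k => A k / T ^ k) (fun k => div_nonneg (hA0 k) (by positivity)) ?_ ?_ ?_
    · intro j hj h hh
      have hint : A (j + 1) ≤ 2 * A j / (h / T) + h / T * A (j + 2) :=
        ciSup_le fun x => norm_iteratedFDeriv_succ_le_interpolation
          (hu.of_le (by exact_mod_cast hj)) (hleA j (by omega)) (hleA (j + 2) hj)
          (by positivity) x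
      calc A (j + 1) / T ^ (j + 1)
          ≤ (2 * A j / (h / T) + h / T * A (j + 2)) / T ^ (j + 1) := by gcongr
        _ = 2 * (A j / T ^ j) / h + h * (A (j + 2) / T ^ (j + 2)) := by
            field_simp
            ring
    · simp only [pow_zero, div_one]
      exact ciSup_le fun x => by simpa using huB x
    · rw [div_le_one (by positivity), hTs]
      linarith
  have hcomp : ∀ n ≤ s, ∀ x, ‖iteratedFDeriv ℝ n (f ∘ u) x‖ ≤ n.factorial * B * (K * T) ^ n := by
    intro n hn x
    refine norm_iteratedFDeriv_comp_le hf hu (by exact_mod_cast hn) x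
      (fun i hi => hfB i (hi.trans hn) _) (fun i hi hin => ?_)
    calc ‖iteratedFDeriv ℝ i u x‖ ≤ A i := hleA i (hin.trans hn) x
      _ ≤ K * T ^ i := (div_le_iff₀ (by positivity)).1 (hAK i (hin.trans hn))
      _ ≤ K ^ i * T ^ i := by
        gcongr
        exact le_self_pow₀ hK (by omega)
      _ = (K * T) ^ i := (mul_pow K T i).symm
  calc cNorm d s (f ∘ u)
      ≤ ∑ i ∈ Finset.range (s + 1), (i.factorial : ℝ) * B * K ^ i * (1 + cNorm d s u) := by
        refine Finset.sum_le_sum fun i hi => ciSup_le fun x => ?_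
        have his : i ≤ s := Nat.lt_succ_iff.1 (Finset.mem_range.1 hi)
        refine (hcomp i his x).trans ?_
        rw [mul_pow, ← mul_assoc, ← hTs]
        gcongr
    _ = (∑ i ∈ Finset.range (s + 1), (i.factorial : ℝ) * B * K ^ i) * (1 + cNorm d s u) :=
        (Finset.sum_mul _ _ _).symm
    _ ≤ _ := by
        gcongr
        linarith
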